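/- Let κ, γ, κ₁, κ₂, φ ∈ ℝ, let τ : ℝ → ℝ³ be twice differentiable with ‖τ(s)‖ = 1 for all s, let ψ, T : ℝ → ℝ with ψ differentiable, and let D₁, D₂ : ℝ → ℝ³ be differentiable such that for every s the triple (D₁(s), D₂(s), τ(s)) is a right-handed orthonormal frame and D₁′ = ω × D₁, D₂′ = ω × D₂ with ω = τ × τ′ + ψ τ. Define N = κ (τ × τ′ − κ₁ D₁ − κ₂ D₂) + γ (ψ − φ) τ and F = −κ (τ″ − κ₁ ψ D₁ − κ₂ ψ D₂) + γ (ψ − φ)(τ × τ′) + T τ. Then for every s, N′(s) + τ(s) × F(s) = n∥(s) τ(s), where n∥ = κ (κ₁ ⟨D₁, τ′⟩ + κ₂ ⟨D₂, τ′⟩) + γ ψ′: for a rod with constant intrinsic curvatures κ₁, κ₂ and intrinsic twist φ, the torque density applied to the fluid is purely tangential. -/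

import Mathlib

open scoped RealInnerProductSpace

noncomputable section

/-- ℝ³ with the Euclidean inner product and norm. -/
abbrev E3 : Type := EuclideanSpace ℝ (Fin 3)

/-- The cross product on ℝ³. -/
def cross3 (u v : E3) : E3 :=
  !₂[u 1 * v 2 - u 2 * v 1, u 2 * v 0 - u 0 * v 2, u 0 * v 1 - u 1 * v 0]

/-- `(u, v, w)` is a right-handed orthonormal frame: all three are unit vectors,
pairwise orthogonal, and `u × v = w`. -/
def IsRHFrame (u v w : E3) : Prop :=
  ‖u‖ = 1 ∧ ‖v‖ = 1 ∧ ‖w‖ = 1 ∧ ⟪u, v⟫ = 0 ∧ ⟪u, w⟫ = 0 ∧ ⟪v, w⟫ = 0 ∧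
    cross3 u v = w

lemma inner3 (u v : E3) : ⟪u, v⟫ = u 0 * v 0 + u 1 * v 1 + u 2 * v 2 := by
  simp [PiLp.inner_apply, Fin.sum_univ_three, mul_comm]

lemma coord_deriv {u : ℝ → E3} {u' : E3} {s : ℝ} (h : HasDerivAt u u' s) (i : Fin 3) :
    HasDerivAt (fun t => u t i) (u' i) s :=
  ((EuclideanSpace.proj (𝕜 := ℝ) i).hasFDerivAt.comp_hasDerivAt s h)

lemma cross3_deriv {u v : ℝ → E3} {u' v' : E3} {s : ℝ} (hu : HasDerivAt u u' s)
    (hv : HasDerivAt v v' s) :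
    HasDerivAt (fun t => cross3 (u t) (v t)) (cross3 u' (v s) + cross3 (u s) v') s := by
  rw [hasDerivAt_iff_hasFDerivAt, ← hasFDerivWithinAt_univ, hasFDerivWithinAt_euclidean]
  intro i
  have key : ∀ j k : Fin 3, HasDerivAt (fun t => u t j * v t k - u t k * v t j)
      ((u' j * v s k - u' k * v s j) + (u s j * v' k - u s k * v' j)) s := by
    intro j k
    have := ((coord_deriv hu j).mul (coord_deriv hv k)).sub
      ((coord_deriv hu k).mul (coord_deriv hv j))
    refine this.congr_deriv ?_
    ring
  rw [hasFDerivWithinAt_univ, hasFDerivAt_iff_hasDerivAt]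
  fin_cases i
  · exact (key 1 2).congr_deriv (by simp [cross3])
  · exact (key 2 0).congr_deriv (by simp [cross3])
  · exact (key 0 1).congr_deriv (by simp [cross3])

lemma cross3_self (u : E3) : cross3 u u = 0 := by
  ext i; fin_cases i <;> simp [cross3] <;> ring

lemma cross3_add_left (a b c : E3) : cross3 (a + b) c = cross3 a c + cross3 b c := by
  ext i; fin_cases i <;> simp [cross3] <;> ring

lemma cross3_add_right (a b c : E3) : cross3 a (b + c) = cross3 a b + cross3 a c := by
  ext i; fin_cases i <;> simp [cross3] <;> ring

lemma cross3_sub_right (a b c : E3) : cross3 a (b - c) = cross3 a b - cross3 a c := by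
  ext i; fin_cases i <;> simp [cross3] <;> ring

lemma cross3_smul_left (r : ℝ) (a b : E3) : cross3 (r • a) b = r • cross3 a b := by
  ext i; fin_cases i <;> simp [cross3] <;> ring

lemma cross3_smul_right (r : ℝ) (a b : E3) : cross3 a (r • b) = r • cross3 a b := by
  ext i; fin_cases i <;> simp [cross3] <;> ring

lemma cross3_triple_left (a b c : E3) :
    cross3 (cross3 a b) c = ⟪c, a⟫ • b - ⟪c, b⟫ • a := by
  ext i; fin_cases i <;> simp [cross3, inner3] <;> ring

lemma cross3_triple_right (a b c : E3) :
    cross3 a (cross3 b c) = ⟪a, c⟫ • b - ⟪a, b⟫ • c := by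
  ext i; fin_cases i <;> simp [cross3, inner3] <;> ring

/-- For a rod with constant intrinsic curvatures `κ₁, κ₂` and intrinsic twist `φ`, with
internal moment `N = κ (τ × τ′ − κ₁ D₁ − κ₂ D₂) + γ (ψ − φ) τ` and force
`F = −κ (τ″ − κ₁ ψ D₁ − κ₂ ψ D₂) + γ (ψ − φ)(τ × τ′) + T τ`, the torque density
applied to the fluid is purely tangential:
`N′ + τ × F = n∥ τ` with `n∥ = κ (κ₁ ⟪D₁, τ′⟫ + κ₂ ⟪D₂, τ′⟫) + γ ψ′`. -/
theorem intrinsic_curvature_torque_is_tangential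
    (κ γ κ₁ κ₂ φ : ℝ)
    (τ : ℝ → E3) (hτ : Differentiable ℝ τ) (hτ' : Differentiable ℝ (deriv τ))
    (hunit : ∀ s, ‖τ s‖ = 1)
    (ψ T : ℝ → ℝ) (hψ : Differentiable ℝ ψ)
    (D₁ D₂ : ℝ → E3) (hD₁ : Differentiable ℝ D₁) (hD₂ : Differentiable ℝ D₂)
    (hframe : ∀ s, IsRHFrame (D₁ s) (D₂ s) (τ s))
    (ω : ℝ → E3)
    (hω : ∀ s, ω s = cross3 (τ s) (deriv τ s) + ψ s • τ s)
    (hD₁' : ∀ s, deriv D₁ s = cross3 (ω s) (D₁ s))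
    (hD₂' : ∀ s, deriv D₂ s = cross3 (ω s) (D₂ s))
    (N F : ℝ → E3)
    (hN : ∀ s, N s = κ • (cross3 (τ s) (deriv τ s) - κ₁ • D₁ s - κ₂ • D₂ s)
        + (γ * (ψ s - φ)) • τ s)
    (hF : ∀ s, F s = -κ • (deriv (deriv τ) s - (κ₁ * ψ s) • D₁ s - (κ₂ * ψ s) • D₂ s)
        + (γ * (ψ s - φ)) • cross3 (τ s) (deriv τ s) + T s • τ s) :
    ∀ s, deriv N s + cross3 (τ s) (F s) =
      (κ * (κ₁ * ⟪D₁ s, deriv τ s⟫ + κ₂ * ⟪D₂ s, deriv τ s⟫) + γ * deriv ψ s) • τ s := by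
  intro s
  obtain ⟨-, -, -, -, h1, h2, -⟩ := hframe s
  have dτ := (hτ s).hasDerivAt
  have hort : ⟪τ s, deriv τ s⟫ = 0 := by
    have h := dτ.inner ℝ dτ
    have hc : (fun t => ⟪τ t, τ t⟫) = fun _ => (1 : ℝ) := by
      funext t
      rw [real_inner_self_eq_norm_sq, hunit]; norm_num
    rw [hc] at h
    have h' := h.unique (hasDerivAt_const s (1 : ℝ))
    rw [real_inner_comm (τ s) (deriv τ s)] at h'
    have := real_inner_comm (τ s) (deriv τ s)
    linarith
  have hττ : ⟪τ s, τ s⟫ = (1 : ℝ) := by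
    rw [real_inner_self_eq_norm_sq, hunit]; norm_num
  have hNd := ((((cross3_deriv dτ (hτ' s).hasDerivAt).sub
      ((hD₁ s).hasDerivAt.const_smul κ₁)).sub
      ((hD₂ s).hasDerivAt.const_smul κ₂)).const_smul κ).add
      ((((hψ s).hasDerivAt.sub_const φ).const_mul γ).smul dτ)
  have hNd' := hNd.congr_of_eventuallyEq (f₁ := N) (Filter.Eventually.of_forall hN)
  rw [hNd'.deriv, hF, hD₁', hD₂', hω]
  simp only [cross3_add_left, cross3_add_right, cross3_sub_right, cross3_smul_left,
    cross3_smul_right, cross3_triple_left, cross3_triple_right, cross3_self, h1, h2, hort, hττ]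
  module
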